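/- Let E be a Banach space and 1 ≤ p < ∞. Then E has the p-approximation property if and only if for every complex Banach space F, the finite-rank holomorphic maps H(F) ⊗ E are dense in the space H_{K_p}(F;E) of p-compact entire functions from F to E with respect to the Nachbin topology τ_ω. -/

import Mathlib

open scoped ENNReal NNReal Classical
open Filter Metric

noncomputable section

/-- Membership in the closed unit ball of `ℓ_q`, where `q` is the conjugate exponent of `p`
(`q = ∞`, i.e. bounded coefficients, when `p = 1`). -/
def ConjUnitBall (p : ℝ) (α : ℕ → ℂ) : Prop :=
  if p = 1 then ∀ n, ‖α n‖ ≤ 1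
  else (Summable fun n => ‖α n‖ ^ (p / (p - 1))) ∧ (∑' n, ‖α n‖ ^ (p / (p - 1))) ≤ 1

variable {E F : Type*} [NormedAddCommGroup E] [NormedSpace ℂ E]
  [NormedAddCommGroup F] [NormedSpace ℂ F]

/-- The `p`-convex hull `p-co{x_n}` of a sequence `(x_n)`. -/
def pCo (p : ℝ) (x : ℕ → F) : Set F :=
  {y | ∃ α : ℕ → ℂ, ConjUnitBall p α ∧ HasSum (fun n => α n • x n) y}

/-- A set is relatively `p`-compact if it is contained in the `p`-convex hull of a
`p`-summable sequence. -/
def IsRelPCompact (p : ℝ) (K : Set F) : Prop :=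
  ∃ x : ℕ → F, (Summable fun n => ‖x n‖ ^ p) ∧ K ⊆ pCo p x

/-- The measure of `p`-compactness `m_p(K)`. -/
def mP (p : ℝ) (K : Set F) : ℝ :=
  sInf {r : ℝ | ∃ x : ℕ → F, (Summable fun n => ‖x n‖ ^ p) ∧ K ⊆ pCo p x ∧
    r = (∑' n, ‖x n‖ ^ p) ^ (1 / p)}

/-- `m_p(K)` as an element of `[0, ∞]`; it equals `∞` when `K` is not relatively
`p`-compact. -/
def mPE (p : ℝ) (K : Set F) : ℝ≥0∞ :=
  sInf {r : ℝ≥0∞ | ∃ x : ℕ → F, (Summable fun n => ‖x n‖ ^ p) ∧ K ⊆ pCo p x ∧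
    r = ENNReal.ofReal ((∑' n, ‖x n‖ ^ p) ^ (1 / p))}

/-- The `m`-homogeneous polynomial `P_m f(x₀)` in the Taylor series expansion of `f` at `x₀`. -/
def taylorPoly (f : E → F) (x₀ : E) (m : ℕ) (x : E) : F :=
  ((m.factorial : ℂ))⁻¹ • iteratedFDeriv ℂ m f x₀ fun _ => x

/-- `f` is `p`-compact at `x₀` if some neighborhood of `x₀` has relatively `p`-compact
image under `f`. -/
def PCompactAt (p : ℝ) (f : E → F) (x₀ : E) : Prop :=
  ∃ V ∈ nhds x₀, IsRelPCompact p (f '' V)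

/-- The radius of `p`-compact convergence of `f` at `x₀`:
`r_p(f, x₀) = 1 / limsup κ_p(P_mf(x₀))^{1/m}` (with the conventions `1/0 = ∞`, and
`κ_p(P) = ∞` when `P` is not `p`-compact, so that `r_p(f,x₀) = 0` in that case). -/
def pRadius (p : ℝ) (f : E → F) (x₀ : E) : ℝ≥0∞ :=
  (Filter.limsup (fun m : ℕ => (mPE p (taylorPoly f x₀ m '' closedBall 0 1)) ^ (1 / (m : ℝ)))
    Filter.atTop)⁻¹

open scoped Pointwise

/-- The `m`-th term `sup{‖P_m h(0)(x)‖ : x ∈ K + a_m B_E}` of the Nachbin seminorm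
associated to an absolutely convex compact set `K` and a null sequence `(a_m)`. -/
def nachbinTerm {E F : Type*} [NormedAddCommGroup E] [NormedSpace ℂ E]
    [NormedAddCommGroup F] [NormedSpace ℂ F]
    (K : Set E) (a : ℕ → ℝ) (h : E → F) (m : ℕ) : ℝ :=
  sSup {r : ℝ | ∃ x ∈ K + closedBall (0 : E) (a m), r = ‖taylorPoly h 0 m x‖}

/-- A Banach space `E` has the `p`-approximation property if the identity map can be
approximated, uniformly on every `p`-compact subset of `E`, by bounded finite-rank
linear operators. -/
def HasPApproxProp (p : ℝ) (E : Type*) [NormedAddCommGroup E] [NormedSpace ℂ E] : Prop :=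
  ∀ K : Set E, IsRelPCompact p K → ∀ ε : ℝ, 0 < ε →
    ∃ T : E →L[ℂ] E, FiniteDimensional ℂ (LinearMap.range (T : E →ₗ[ℂ] E)) ∧
      ∀ x ∈ K, ‖T x - x‖ ≤ ε

section Auxiliary

/-- The unit ball describing the coefficients in `pCo p` is that of `ℓ_q`, `q` conjugate to `p`. -/
lemma exists_conjUnitBall_iff_lp {p : ℝ} (hp : 1 ≤ p) :
    ∃ q : ℝ≥0∞, 1 ≤ q ∧ (ENNReal.ofReal p).HolderConjugate q ∧
      ∀ α : ℕ → ℂ, ConjUnitBall p α ↔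
        ∃ a : lp (fun _ : ℕ => ℂ) q, ‖a‖ ≤ 1 ∧ ∀ n, a n = α n := by
  rcases hp.eq_or_lt with rfl | hp
  · refine ⟨∞, le_top, by simpa using (inferInstance : ENNReal.HolderConjugate 1 ∞), fun α => ?_⟩
    rw [ConjUnitBall, if_pos rfl]
    refine ⟨fun h => ⟨⟨α, memℓp_infty ⟨1, ?_⟩⟩, ?_, fun n => rfl⟩, ?_⟩
    · rintro _ ⟨n, rfl⟩
      exact h n
    · exact lp.norm_le_of_forall_le zero_le_one h
    · rintro ⟨a, ha, hα⟩ n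
      rw [← hα]
      exact (lp.norm_apply_le_norm (by simp) a n).trans ha
  · have hpq : p.HolderConjugate (p / (p - 1)) := Real.HolderConjugate.conjExponent hp
    have hq : (ENNReal.ofReal (p / (p - 1))).toReal = p / (p - 1) :=
      ENNReal.toReal_ofReal hpq.symm.nonneg
    have hq0 : 0 < (ENNReal.ofReal (p / (p - 1))).toReal := by
      rw [hq]
      exact hpq.symm.pos
    refine ⟨ENNReal.ofReal (p / (p - 1)), by simpa using hpq.symm.lt.le, hpq.ennrealOfReal,
      fun α => ?_⟩
    rw [ConjUnitBall, if_neg hp.ne']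
    constructor
    · rintro ⟨hs, h1⟩
      refine ⟨⟨α, memℓp_gen (by simpa only [hq] using hs)⟩, ?_, fun n => rfl⟩
      refine lp.norm_le_of_tsum_le hq0 zero_le_one ?_
      simpa only [hq, Real.one_rpow] using h1
    · rintro ⟨a, ha, hα⟩
      obtain rfl : (fun n => a n) = α := funext hα
      refine ⟨by simpa only [hq] using (lp.memℓp a).summable hq0, ?_⟩
      have := lp.norm_rpow_eq_tsum hq0 a
      rw [hq] at this
      rw [← this]
      exact Real.rpow_le_one (lp.norm_nonneg' _) ha hpq.symm.nonneg

/-- The terms of a summable nonnegative series can be enlarged by factors tending to infinity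
without destroying summability. -/
lemma exists_tendsto_zero_mul_summable {a : ℕ → ℝ} (ha0 : ∀ n, 0 ≤ a n) (ha : Summable a) :
    ∃ c : ℕ → ℝ, (∀ n, 0 ≤ c n) ∧ Tendsto c atTop (nhds 0) ∧
      Summable (fun n => a n / c n) ∧ ∀ n, c n = 0 → a n = 0 := by
  set r : ℕ → ℝ := fun n => ∑' k, a (k + n) with hr
  have hr0 : ∀ n, 0 ≤ r n := fun n => tsum_nonneg fun k => ha0 _
  have hrs : ∀ n, r n = a n + r (n + 1) := fun n => by
    have := ((summable_nat_add_iff n).2 ha).tsum_eq_zero_add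
    simp only [hr]
    rw [this, zero_add]
    congr 1
    exact tsum_congr fun k => by ring_nf
  have key : ∀ n, a n / √(r n) ≤ 2 * (√(r n) - √(r (n + 1))) := fun n => by
    have hle : √(r (n + 1)) ≤ √(r n) := Real.sqrt_le_sqrt (by linarith [hrs n, ha0 n])
    rcases (Real.sqrt_nonneg (r n)).eq_or_lt with h | h
    · rw [← h] at hle ⊢
      simp only [div_zero]
      linarith
    · rw [div_le_iff₀ h]
      nlinarith [Real.sq_sqrt (hr0 n), Real.sq_sqrt (hr0 (n + 1)), hrs n,
        Real.sqrt_nonneg (r (n + 1))]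
  refine ⟨fun n => √(r n), fun n => Real.sqrt_nonneg _, ?_, ?_, ?_⟩
  · simpa only [Real.sqrt_zero, hr, Function.comp_def] using
      (Real.continuous_sqrt.tendsto 0).comp (tendsto_sum_nat_add a)
  · refine summable_of_sum_range_le (c := 2 * √(r 0))
      (fun n => div_nonneg (ha0 n) (Real.sqrt_nonneg _)) fun n => ?_
    refine (Finset.sum_le_sum fun i _ => key i).trans ?_
    rw [← Finset.mul_sum, Finset.sum_range_sub']
    linarith [Real.sqrt_nonneg (r n)]
  · intro n hn
    have := (Real.sqrt_eq_zero (hr0 n)).1 hn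
    linarith [hrs n, ha0 n, hr0 (n + 1)]

/-- A `p`-summable sequence is the product of a null sequence and a `p`-summable sequence. -/
lemma exists_null_smul_summable {E : Type*} [NormedAddCommGroup E] [NormedSpace ℂ E]
    {p : ℝ} (hp : 1 ≤ p) {x : ℕ → E} (hx : Summable fun n => ‖x n‖ ^ p) :
    ∃ (c : ℕ → ℝ) (y : ℕ → E), (∀ n, 0 ≤ c n) ∧ Tendsto c atTop (nhds 0) ∧
      (Summable fun n => ‖y n‖ ^ p) ∧ ∀ n, x n = (c n : ℂ) • y n := by
  have hp0 : 0 < p := zero_lt_one.trans_le hp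
  obtain ⟨c, hc0, hc, hs, hz⟩ := exists_tendsto_zero_mul_summable
    (fun n => Real.rpow_nonneg (norm_nonneg (x n)) p) hx
  have hcp : ∀ n, (c n ^ p⁻¹) ^ p = c n := fun n => Real.rpow_inv_rpow (hc0 n) hp0.ne'
  have hd0 : ∀ n, 0 ≤ c n ^ p⁻¹ := fun n => Real.rpow_nonneg (hc0 n) _
  refine ⟨fun n => c n ^ p⁻¹, fun n => ((c n ^ p⁻¹ : ℝ) : ℂ)⁻¹ • x n, hd0, ?_, ?_, fun n => ?_⟩
  · simpa [Real.zero_rpow (inv_ne_zero hp0.ne')] using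
      hc.rpow_const (p := p⁻¹) (Or.inr (inv_nonneg.2 hp0.le))
  · refine hs.congr fun n => ?_
    rw [norm_smul, norm_inv, Complex.norm_real, Real.norm_of_nonneg (hd0 n),
      Real.mul_rpow (inv_nonneg.2 (hd0 n)) (norm_nonneg _), Real.inv_rpow (hd0 n), hcp,
      div_eq_inv_mul]
  · rcases eq_or_ne (c n ^ p⁻¹) 0 with h | h
    · have hc' : c n = 0 := by rw [← hcp n, h, Real.zero_rpow hp0.ne']
      have hx0 := hz n hc'
      rw [Real.rpow_eq_zero (norm_nonneg _) hp0.ne', norm_eq_zero] at hx0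
      simp [hx0]
    · rw [smul_inv_smul₀ (by exact_mod_cast h)]

/-- The `p`-summable sequence `y` defines an operator on `ℓ_q`. -/
lemma exists_lp_operator {E : Type*} [NormedAddCommGroup E] [NormedSpace ℂ E] [CompleteSpace E]
    {p : ℝ} (hp : 1 ≤ p) {q : ℝ≥0∞} [Fact (1 ≤ q)] (hpq : (ENNReal.ofReal p).HolderConjugate q)
    {y : ℕ → E} (hy : Summable fun n => ‖y n‖ ^ p) :
    ∃ S : lp (fun _ : ℕ => ℂ) q →L[ℂ] E, ∀ a, HasSum (fun n => a n • y n) (S a) := by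
  have hp0 : 0 < p := zero_lt_one.trans_le hp
  have : Fact (1 ≤ ENNReal.ofReal p) := ⟨by simpa using hp⟩
  have hpr : (ENNReal.ofReal p).toReal = p := ENNReal.toReal_ofReal hp0.le
  let Y : lp (fun _ : ℕ => E) (ENNReal.ofReal p) :=
    ⟨y, memℓp_gen (by simpa only [hpr] using hy)⟩
  let B : ℕ → E →L[ℂ] ℂ →L[ℂ] E := fun _ => (ContinuousLinearMap.lsmul ℂ ℂ).flip
  have hB : ∀ n, ‖B n‖ ≤ (‖B 0‖₊ : ℝ≥0) := fun n => le_rfl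
  refine ⟨lp.dualPairing (ENNReal.ofReal p) q B hB Y, fun a => ?_⟩
  have hs : Summable fun n => a n • y n :=
    Memℓp.summable_of_one ((lp.memℓp Y).holder 1 (lp.memℓp a) B hB)
  exact hs.hasSum

/-- Diagonal operators with null coefficients on `ℓ_q` are approximable by finite rank ones. -/
lemma exists_lp_diagonal {q : ℝ≥0∞} [Fact (1 ≤ q)] {c : ℕ → ℝ} (hc0 : ∀ n, 0 ≤ c n)
    (hc : Tendsto c atTop (nhds 0)) :
    ∃ D : lp (fun _ : ℕ => ℂ) q →L[ℂ] lp (fun _ : ℕ => ℂ) q,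
      (∀ a n, D a n = (c n : ℂ) * a n) ∧
      ∀ ε : ℝ, 0 < ε → ∃ (N : ℕ) (e : Fin N → lp (fun _ : ℕ => ℂ) q →L[ℂ] ℂ)
        (v : Fin N → lp (fun _ : ℕ => ℂ) q), ‖D - ∑ i, (e i).smulRight (v i)‖ ≤ ε := by
  have hn : ∀ z : ℂ, ‖z • ContinuousLinearMap.id ℂ ℂ‖ = ‖z‖ := fun z => by
    rw [norm_smul, ContinuousLinearMap.norm_id, mul_one]
  obtain ⟨M, hM⟩ := hc.bddAbove_range
  have hM' : ∀ n, c n ≤ M := fun n => hM ⟨n, rfl⟩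
  have hb : ∀ n, ‖(c n : ℂ) • ContinuousLinearMap.id ℂ ℂ‖ ≤ M := fun n => by
    rw [hn, Complex.norm_real, Real.norm_of_nonneg (hc0 n)]
    exact hM' n
  refine ⟨lp.mapCLM q (fun n => (c n : ℂ) • ContinuousLinearMap.id ℂ ℂ)
    ((hc0 0).trans (hM' 0)) hb, fun a n => by simp, fun ε hε => ?_⟩
  obtain ⟨N, hN⟩ := eventually_atTop.1 (hc.eventually_le_const hε)
  refine ⟨N, fun i => (c i : ℂ) • lp.evalCLM ℂ (fun _ : ℕ => ℂ) q i,
    fun i => lp.single q (i : ℕ) (1 : ℂ), ?_⟩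
  have hb' : ∀ n, ‖(if n < N then (0 : ℂ) else c n) • ContinuousLinearMap.id ℂ ℂ‖ ≤ ε :=
    fun n => by
      rw [hn]
      split_ifs with h
      · simpa using hε.le
      · rw [Complex.norm_real, Real.norm_of_nonneg (hc0 n)]
        exact hN n (not_lt.1 h)
  convert! lp.norm_mapCLM_le q _ hε.le hb' using 2
  ext a n
  simp only [_root_.sub_apply, lp.coeFn_sub, Pi.sub_apply,
    _root_.sum_apply, lp.coeFn_sum, Finset.sum_apply]
  simp only [lp.mapCLM_apply_coe, ContinuousLinearMap.smulRight_apply, lp.coeFn_smul,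
    Pi.smul_apply, lp.single_apply, _root_.smul_apply]
  have hs : ∀ i : Fin N, ((c i : ℂ) • lp.evalCLM ℂ (fun _ : ℕ => ℂ) q i a) •
      (Pi.single (i : ℕ) (1 : ℂ) : ℕ → ℂ) n = if n = i then (c n : ℂ) * a n else 0 := fun i => by
    rw [Pi.single_apply]
    split_ifs with h
    · subst h
      simp [lp.evalCLM]
    · simp
  rw [Finset.sum_congr rfl fun i _ => hs i,
    Fin.sum_univ_eq_sum_range (fun i => if n = i then (c n : ℂ) * a n else 0) N,
    Finset.sum_ite_eq]
  by_cases h : n < N <;> simp [h]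

end Auxiliary

section Grothendieck

variable {X Q E : Type*} [NormedAddCommGroup X] [NormedSpace ℂ X]
  [NormedAddCommGroup Q] [NormedSpace ℂ Q] [NormedAddCommGroup E] [NormedSpace ℂ E]

/-- A point outside a closed subspace is separated from it by a functional vanishing on it. -/
lemma exists_dual_ne_zero_of_notMem {M : Submodule ℂ X} (hM : IsClosed (M : Set X)) {x : X}
    (hx : x ∉ M) : ∃ g : X →L[ℂ] ℂ, g x ≠ 0 ∧ ∀ m ∈ M, g m = 0 := by
  have hne : ‖(Submodule.Quotient.mk x : X ⧸ M)‖ ≠ 0 := by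
    have : (Submodule.Quotient.mk x : X ⧸ M) ≠ 0 := by rwa [Ne, Submodule.Quotient.mk_eq_zero]
    exact norm_ne_zero_iff.2 this
  obtain ⟨g, -, hg⟩ := exists_dual_vector ℂ _ hne
  refine ⟨g ∘L M.mkQL, ?_, fun m hm => ?_⟩
  · have : g (M.mkQL x) ≠ 0 := by
      rw [Submodule.mkQL_apply, Submodule.mkQ_apply, hg]
      exact RCLike.ofReal_ne_zero.2 hne
    exact this
  · have : M.mkQL m = 0 := by
      rwa [Submodule.mkQL_apply, Submodule.mkQ_apply, Submodule.Quotient.mk_eq_zero]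
    rw [ContinuousLinearMap.comp_apply, this, map_zero]

/-- If `C` is approximable by finite rank operators then its second adjoint takes values in the
original space. -/
lemma exists_eq_double_adjoint [CompleteSpace Q] {C : X →L[ℂ] Q}
    (hC : ∀ ε : ℝ, 0 < ε → ∃ (N : ℕ) (e : Fin N → X →L[ℂ] ℂ) (v : Fin N → Q),
      ‖C - ∑ i, (e i).smulRight (v i)‖ ≤ ε) (ξ : (X →L[ℂ] ℂ) →L[ℂ] ℂ) :
    ∃ z : Q, ∀ φ : Q →L[ℂ] ℂ, ξ (φ ∘L C) = φ z := by
  have hclosed : IsClosed (Set.range (NormedSpace.inclusionInDoubleDualLi (E := Q) ℂ)) := by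
    have hi : Isometry (NormedSpace.inclusionInDoubleDualLi (E := Q) ℂ) :=
      LinearIsometry.isometry _
    exact hi.isClosedEmbedding.isClosed_range
  let Ψ : (X →L[ℂ] Q) →L[ℂ] (Q →L[ℂ] ℂ) →L[ℂ] ℂ :=
    (ContinuousLinearMap.compL ℂ (Q →L[ℂ] ℂ) (X →L[ℂ] ℂ) ℂ ξ) ∘L
      (ContinuousLinearMap.compL ℂ X Q ℂ).flip
  have hΨ : ∀ c φ, Ψ c φ = ξ (φ ∘L c) := fun c φ => rfl
  have hmem : C ∈ Ψ ⁻¹' Set.range (NormedSpace.inclusionInDoubleDualLi (E := Q) ℂ) := by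
    refine (hclosed.preimage Ψ.continuous).closure_subset (Metric.mem_closure_iff.2 fun ε hε => ?_)
    obtain ⟨N, e, v, h⟩ := hC (ε / 2) (half_pos hε)
    refine ⟨_, ⟨∑ i, ξ (e i) • v i, ?_⟩, (dist_eq_norm _ _).trans_lt (h.trans_lt (half_lt_self hε))⟩
    ext φ
    rw [hΨ]
    have : φ ∘L (∑ i, (e i).smulRight (v i)) = ∑ i, φ (v i) • e i := by
      ext x
      simp [mul_comm]
    rw [this]
    change φ (∑ i, ξ (e i) • v i) = _
    simp [mul_comm]
  obtain ⟨z, hz⟩ := hmem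
  exact ⟨z, fun φ => by rw [← hΨ, ← hz]; rfl⟩

/-- If `j` is injective and `C` is approximable by finite rank operators, then functionals on the
domain of `j` can be approximated on the image of the unit ball under `C` by functionals that
factor through `j`. -/
lemma exists_dual_approx [CompleteSpace Q] {C : X →L[ℂ] Q}
    (hC : ∀ ε : ℝ, 0 < ε → ∃ (N : ℕ) (e : Fin N → X →L[ℂ] ℂ) (v : Fin N → Q),
      ‖C - ∑ i, (e i).smulRight (v i)‖ ≤ ε) {j : Q →L[ℂ] E} (hj : Function.Injective j)
    (φ : Q →L[ℂ] ℂ) {δ : ℝ} (hδ : 0 < δ) :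
    ∃ ψ : E →L[ℂ] ℂ, ‖φ ∘L C - ψ ∘L j ∘L C‖ ≤ δ := by
  let M : Submodule ℂ (X →L[ℂ] ℂ) :=
    LinearMap.range ((ContinuousLinearMap.compL ℂ X E ℂ).flip (j ∘L C) : (E →L[ℂ] ℂ) →ₗ[ℂ] _)
  suffices h : φ ∘L C ∈ M.topologicalClosure by
    obtain ⟨_, ⟨ψ, rfl⟩, hψ⟩ := Metric.mem_closure_iff.1 h δ hδ
    rw [dist_eq_norm] at hψ
    exact ⟨ψ, hψ.le⟩
  by_contra h
  obtain ⟨g, hg, hgM⟩ := exists_dual_ne_zero_of_notMem M.isClosed_topologicalClosure h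
  obtain ⟨z, hz⟩ := exists_eq_double_adjoint hC g
  have hz0 : j z = 0 := by
    refine SeparatingDual.eq_zero_of_forall_dual_eq_zero (R := ℂ) fun ψ => ?_
    have := hz (ψ ∘L j)
    rw [ContinuousLinearMap.comp_assoc, hgM (ψ ∘L j ∘L C) (M.le_topologicalClosure ⟨ψ, rfl⟩)] at this
    exact this.symm
  have : z = 0 := hj (by rw [hz0, map_zero])
  have hφ := hz φ
  rw [this, map_zero] at hφ
  exact hg hφ

/-- If an injective operator `j` is a norm limit of finite rank operators, then the identity can be
approximated by finite rank operators on the image of the unit ball under `j ∘ C`. -/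
lemma exists_finiteRank_approx [CompleteSpace Q] {C : X →L[ℂ] Q}
    (hC : ∀ ε : ℝ, 0 < ε → ∃ (N : ℕ) (e : Fin N → X →L[ℂ] ℂ) (v : Fin N → Q),
      ‖C - ∑ i, (e i).smulRight (v i)‖ ≤ ε) {j : Q →L[ℂ] E} (hj : Function.Injective j)
    (hR : ∀ ε : ℝ, 0 < ε → ∃ (N : ℕ) (e : Fin N → Q →L[ℂ] ℂ) (v : Fin N → E),
      ‖j - ∑ i, (e i).smulRight (v i)‖ ≤ ε) {ε : ℝ} (hε : 0 < ε) :
    ∃ T : E →L[ℂ] E, FiniteDimensional ℂ (LinearMap.range (T : E →ₗ[ℂ] E)) ∧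
      ∀ x : X, ‖x‖ ≤ 1 → ‖T (j (C x)) - j (C x)‖ ≤ ε := by
  obtain ⟨N, e, v, hN⟩ := hR (ε / 2 / (‖C‖ + 1)) (by positivity)
  set S := ∑ i, ‖v i‖ with hS
  have hS0 : 0 ≤ S := Finset.sum_nonneg fun _ _ => norm_nonneg _
  choose ψ hψ using fun i => exists_dual_approx hC hj (e i) (δ := ε / 2 / (S + 1)) (by positivity)
  refine ⟨∑ i, (ψ i).smulRight (v i), ?_, fun x hx => ?_⟩
  · have hle : LinearMap.range ((∑ i, (ψ i).smulRight (v i) : E →L[ℂ] E) : E →ₗ[ℂ] E) ≤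
        Submodule.span ℂ (Set.range v) := by
      rintro _ ⟨x, rfl⟩
      simp only [ContinuousLinearMap.coe_coe, _root_.sum_apply,
        ContinuousLinearMap.smulRight_apply]
      exact Submodule.sum_mem _ fun i _ => Submodule.smul_mem _ _ (Submodule.subset_span ⟨i, rfl⟩)
    have := FiniteDimensional.span_of_finite ℂ (Set.finite_range v)
    exact Submodule.finiteDimensional_of_le hle
  · have h1 : ‖j (C x) - ∑ i, e i (C x) • v i‖ ≤ ε / 2 := by
      have := (j - ∑ i, (e i).smulRight (v i)).le_of_opNorm_le hN (C x)
      simp only [_root_.sub_apply, _root_.sum_apply,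
        ContinuousLinearMap.smulRight_apply] at this
      have hCx : ‖C x‖ ≤ ‖C‖ + 1 := by
        have := C.le_opNorm_of_le hx
        linarith
      refine this.trans ?_
      rw [div_mul_eq_mul_div, div_le_iff₀ (by positivity)]
      gcongr
    have h2 : ‖∑ i, e i (C x) • v i - ∑ i, ψ i (j (C x)) • v i‖ ≤ ε / 2 := by
      rw [← Finset.sum_sub_distrib]
      calc ‖∑ i, (e i (C x) • v i - ψ i (j (C x)) • v i)‖
          ≤ ∑ i, ε / 2 / (S + 1) * ‖v i‖ := by
            refine norm_sum_le_of_le _ fun i _ => ?_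
            rw [← sub_smul, norm_smul]
            gcongr
            have := (e i ∘L C - ψ i ∘L j ∘L C).le_of_opNorm_le (hψ i) x
            simp only [_root_.sub_apply, ContinuousLinearMap.comp_apply] at this
            refine this.trans (mul_le_of_le_one_right (by positivity) hx)
        _ = ε / 2 * (S / (S + 1)) := by rw [← Finset.mul_sum]; ring
        _ ≤ ε / 2 := mul_le_of_le_one_right (by positivity)
            ((div_le_one (by positivity)).2 (by linarith))
    simp only [_root_.sum_apply, ContinuousLinearMap.smulRight_apply]
    rw [norm_sub_rev]
    calc _ ≤ _ := norm_sub_le_norm_sub_add_norm_sub _ (∑ i, e i (C x) • v i) _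
      _ ≤ ε := by linarith

end Grothendieck

section Taylor

variable {F G : Type*} [NormedAddCommGroup F] [NormedSpace ℂ F]
  [NormedAddCommGroup G] [NormedSpace ℂ G]

lemma contDiff_of_forall_analyticAt [CompleteSpace G] {h : F → G}
    (hh : ∀ x, AnalyticAt ℂ h x) : ContDiff ℂ ⊤ h :=
  AnalyticOnNhd.contDiff fun x _ => hh x

lemma taylorPoly_smul (h : F → G) (m : ℕ) (c : ℂ) (x : F) :
    taylorPoly h 0 m (c • x) = c ^ m • taylorPoly h 0 m x := by
  have := (iteratedFDeriv ℂ m h 0).map_smul_univ (fun _ => c) (fun _ => x)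
  simp only [Finset.prod_const, Finset.card_univ, Fintype.card_fin] at this
  rw [taylorPoly, taylorPoly, this, smul_comm]

lemma bddAbove_taylorPoly (h : F → G) (m : ℕ) {S : Set F} (hS : Bornology.IsBounded S) :
    BddAbove {r : ℝ | ∃ x ∈ S, r = ‖taylorPoly h 0 m x‖} := by
  obtain ⟨R, hR⟩ := hS.exists_norm_le
  refine ⟨‖((m.factorial : ℂ))⁻¹‖ * (‖iteratedFDeriv ℂ m h 0‖ * R ^ m), ?_⟩
  rintro _ ⟨x, hx, rfl⟩
  rw [taylorPoly, norm_smul]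
  gcongr
  refine (ContinuousMultilinearMap.le_opNorm _ _).trans ?_
  simp only [Finset.prod_const, Finset.card_univ, Fintype.card_fin]
  gcongr
  exact hR x hx

/-- Cauchy's estimate for Taylor polynomials of entire maps. -/
lemma norm_taylorPoly_le [CompleteSpace G] {h : F → G} (hh : ∀ x, AnalyticAt ℂ h x) (m : ℕ)
    {w : F} {C : ℝ} (hC : ∀ ζ : ℂ, ‖ζ‖ = 1 → ‖h (ζ • w)‖ ≤ C) : ‖taylorPoly h 0 m w‖ ≤ C := by
  let L : ℂ →L[ℂ] F := ContinuousLinearMap.toSpanSingleton ℂ w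
  have hcd : ContDiff ℂ ⊤ h := contDiff_of_forall_analyticAt hh
  have h1 : iteratedDeriv m (h ∘ L) 0 = iteratedFDeriv ℂ m h 0 fun _ => w := by
    rw [iteratedDeriv_eq_iteratedFDeriv,
      L.iteratedFDeriv_comp_right (hcd.of_le (n := ⊤) le_top) 0 (i := m) (by exact_mod_cast le_top)]
    simp [L]
  have hd : Differentiable ℂ (h ∘ L) :=
    (hcd.differentiable (by simp)).comp L.differentiable
  have h2 := Complex.norm_iteratedDeriv_le_of_forall_mem_sphere_norm_le (c := 0) (R := 1) (C := C) m
    one_pos hd.diffContOnCl fun z hz => hC z (by simpa using hz)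
  rw [h1, one_pow, div_one] at h2
  rw [taylorPoly, norm_smul, norm_inv, Complex.norm_natCast]
  rwa [inv_mul_le_iff₀ (by positivity)]

/-- The degree one Taylor polynomial is the derivative. -/
lemma taylorPoly_one (h : F → G) (x : F) : taylorPoly h 0 1 x = fderiv ℂ h 0 x := by
  simp [taylorPoly, iteratedFDeriv_one_apply]

open scoped Pointwise in
lemma nachbinTerm_nonneg (K : Set F) (a : ℕ → ℝ) (h : F → G) (m : ℕ) :
    0 ≤ nachbinTerm K a h m := by
  refine Real.sSup_nonneg ?_
  rintro _ ⟨x, -, rfl⟩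
  exact norm_nonneg _

/-- Density of the finite rank entire maps forces `p`-compact operators to be approximable. -/
lemma exists_finiteRank_of_nachbin [CompleteSpace G] (j : F →L[ℂ] G)
    (h : ∀ (K : Set F), IsCompact K → Convex ℝ K → Balanced ℂ K →
        ∀ (a : ℕ → ℝ), (∀ m, 0 < a m) → Filter.Tendsto a Filter.atTop (nhds 0) →
        ∀ ε : ℝ, 0 < ε →
          ∃ (n : ℕ) (g : Fin n → F → ℂ) (v : Fin n → G),
            (∀ i, ∀ x, AnalyticAt ℂ (g i) x) ∧
            (Summable fun m =>
              nachbinTerm K a (fun y => j y - ∑ i, g i y • v i) m) ∧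
            (∑' m, nachbinTerm K a (fun y => j y - ∑ i, g i y • v i) m) ≤ ε)
    {ε : ℝ} (hε : 0 < ε) :
    ∃ (N : ℕ) (e : Fin N → F →L[ℂ] ℂ) (v : Fin N → G),
      ‖j - ∑ i, (e i).smulRight (v i)‖ ≤ ε := by
  obtain ⟨n, g, v, hg, hs, hle⟩ := h {0} isCompact_singleton (convex_singleton 0)
    (by rintro c - _ ⟨x, rfl, rfl⟩; simp) (fun m => 2 * (1 / ((m : ℝ) + 1)))
    (fun m => by positivity)
    (by simpa using (tendsto_one_div_add_atTop_nhds_zero_nat (𝕜 := ℝ)).const_mul 2) ε hε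
  refine ⟨n, fun i => fderiv ℂ (g i) 0, v, ?_⟩
  set H : F → G := fun y => j y - ∑ i, g i y • v i with hH
  have hfd : HasFDerivAt H (j - ∑ i, (fderiv ℂ (g i) 0).smulRight (v i)) 0 :=
    j.hasFDerivAt.sub <| HasFDerivAt.fun_sum fun i _ =>
      ((hg i 0).differentiableAt.hasFDerivAt.smul_const (v i))
  have h1 := (hs.le_tsum 1 fun m _ => nachbinTerm_nonneg _ _ _ _).trans hle
  let : NormedSpace ℝ F := NormedSpace.restrictScalars ℝ ℂ F
  refine ContinuousLinearMap.opNorm_le_of_unit_norm hε.le fun x hx => ?_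
  refine le_trans (le_csSup (bddAbove_taylorPoly H 1 ?_) ⟨x, ?_, ?_⟩) h1
  · exact isCompact_singleton.isBounded.add isBounded_closedBall
  · exact ⟨0, rfl, x, by norm_num [hx], zero_add x⟩
  · rw [taylorPoly_one, hfd.fderiv]

/-- The sequence `s 0, t 0, s 1, t 1, …`. -/
def interleave {α : Type*} (s t : ℕ → α) (n : ℕ) : α := if Even n then s (n / 2) else t (n / 2)

lemma interleave_even {α : Type*} (s t : ℕ → α) (n : ℕ) : interleave s t (2 * n) = s n := by
  simp [interleave]

lemma interleave_odd {α : Type*} (s t : ℕ → α) (n : ℕ) : interleave s t (2 * n + 1) = t n := by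
  rw [interleave, if_neg (by simp), show (2 * n + 1) / 2 = n by lia]

lemma conjUnitBall_interleave_left {p : ℝ} (hp : 1 ≤ p) {α : ℕ → ℂ} (hα : ConjUnitBall p α) :
    ConjUnitBall p (interleave α 0) := by
  unfold ConjUnitBall at hα ⊢
  split_ifs at hα ⊢ with h
  · intro n
    obtain ⟨k, rfl | rfl⟩ := Nat.even_or_odd' n
    · rw [interleave_even]
      exact hα k
    · simp [interleave_odd]
  · have hpos : 0 < p / (p - 1) :=
      (Real.HolderConjugate.conjExponent (lt_of_le_of_ne hp (Ne.symm h))).symm.pos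
    have key : HasSum (fun n => ‖interleave α 0 n‖ ^ (p / (p - 1)))
        ((∑' n, ‖α n‖ ^ (p / (p - 1))) + 0) := by
      refine HasSum.even_add_odd ?_ ?_
      · simpa only [interleave_even] using hα.1.hasSum
      · simp [interleave_odd, Real.zero_rpow hpos.ne', hasSum_zero]
    refine ⟨key.summable, ?_⟩
    rw [key.tsum_eq, add_zero]
    exact hα.2

lemma conjUnitBall_interleave_right {p : ℝ} (hp : 1 ≤ p) {α : ℕ → ℂ} (hα : ConjUnitBall p α) :
    ConjUnitBall p (interleave 0 α) := by
  unfold ConjUnitBall at hα ⊢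
  split_ifs at hα ⊢ with h
  · intro n
    obtain ⟨k, rfl | rfl⟩ := Nat.even_or_odd' n
    · simp [interleave_even]
    · rw [interleave_odd]
      exact hα k
  · have hpos : 0 < p / (p - 1) :=
      (Real.HolderConjugate.conjExponent (lt_of_le_of_ne hp (Ne.symm h))).symm.pos
    have key : HasSum (fun n => ‖interleave 0 α n‖ ^ (p / (p - 1)))
        (0 + ∑' n, ‖α n‖ ^ (p / (p - 1))) := by
      refine HasSum.even_add_odd ?_ ?_
      · simp [interleave_even, Real.zero_rpow hpos.ne', hasSum_zero]
      · simpa only [interleave_odd] using hα.1.hasSum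
    refine ⟨key.summable, ?_⟩
    rw [key.tsum_eq, zero_add]
    exact hα.2

/-- Unions of two relatively `p`-compact sets are relatively `p`-compact. -/
lemma IsRelPCompact.union {p : ℝ} (hp : 1 ≤ p) {A B : Set G} (hA : IsRelPCompact p A)
    (hB : IsRelPCompact p B) : IsRelPCompact p (A ∪ B) := by
  obtain ⟨x, hx, hAx⟩ := hA
  obtain ⟨y, hy, hBy⟩ := hB
  refine ⟨interleave x y, (HasSum.even_add_odd (m := ∑' n, ‖x n‖ ^ p) (m' := ∑' n, ‖y n‖ ^ p)
    ?_ ?_).summable, ?_⟩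
  · simpa only [interleave_even] using hx.hasSum
  · simpa only [interleave_odd] using hy.hasSum
  · rintro z (hz | hz)
    · obtain ⟨α, hα, hs⟩ := hAx hz
      refine ⟨interleave α 0, conjUnitBall_interleave_left hp hα, ?_⟩
      rw [← add_zero z]
      refine HasSum.even_add_odd ?_ ?_
      · simpa only [interleave_even] using hs
      · simp [interleave_odd, hasSum_zero]
    · obtain ⟨α, hα, hs⟩ := hBy hz
      refine ⟨interleave 0 α, conjUnitBall_interleave_right hp hα, ?_⟩
      rw [← zero_add z]
      refine HasSum.even_add_odd ?_ ?_
      · simp [interleave_even, hasSum_zero]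
      · simpa only [interleave_odd] using hs

lemma IsRelPCompact.empty {p : ℝ} (hp : 1 ≤ p) : IsRelPCompact p (∅ : Set G) :=
  ⟨0, by simp [Real.zero_rpow (zero_lt_one.trans_le hp).ne', summable_zero], Set.empty_subset _⟩

lemma IsRelPCompact.mono {p : ℝ} {A B : Set G} (hB : IsRelPCompact p B) (h : A ⊆ B) :
    IsRelPCompact p A :=
  let ⟨x, hx, hBx⟩ := hB
  ⟨x, hx, h.trans hBx⟩

/-- A locally `p`-compact map is `p`-compact on a uniform neighborhood of each compact set. -/
lemma exists_cthickening_isRelPCompact {F G : Type*} [NormedAddCommGroup F] [NormedAddCommGroup G]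
    [NormedSpace ℂ G] {p : ℝ} (hp : 1 ≤ p) {f : F → G}
    (hf : ∀ x, PCompactAt p f x) {K : Set F} (hK : IsCompact K) :
    ∃ δ : ℝ, 0 < δ ∧ IsRelPCompact p (f '' cthickening δ K) := by
  obtain ⟨U, hU, hUK, hUf⟩ : ∃ U, IsOpen U ∧ K ⊆ U ∧ IsRelPCompact p (f '' U) := by
    refine hK.induction_on (p := fun s => ∃ U, IsOpen U ∧ s ⊆ U ∧ IsRelPCompact p (f '' U))
      ⟨∅, isOpen_empty, subset_rfl, by simpa using IsRelPCompact.empty hp⟩ ?_ ?_ ?_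
    · rintro s t hst ⟨U, hU, htU, h⟩
      exact ⟨U, hU, hst.trans htU, h⟩
    · rintro s t ⟨U, hU, hsU, h⟩ ⟨V, hV, htV, h'⟩
      refine ⟨U ∪ V, hU.union hV, Set.union_subset_union hsU htV, ?_⟩
      rw [Set.image_union]
      exact h.union hp h'
    · intro x _
      obtain ⟨V, hV, h⟩ := hf x
      obtain ⟨W, hWV, hW, hxW⟩ := _root_.mem_nhds_iff.1 hV
      exact ⟨W, mem_nhdsWithin_of_mem_nhds (hW.mem_nhds hxW), W, hW, subset_rfl,
        h.mono (Set.image_mono hWV)⟩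
  obtain ⟨δ, hδ, h⟩ := hK.exists_cthickening_subset_open hU hUK
  exact ⟨δ, hδ, hUf.mono (Set.image_mono h)⟩

end Taylor

universe u

/-- The `p`-approximation property implies density of the finite rank entire maps. -/
lemma HasPApproxProp.exists_nachbin_approx {E F : Type*} [NormedAddCommGroup E] [NormedSpace ℂ E]
    [CompleteSpace E] [NormedAddCommGroup F] [NormedSpace ℂ F] {p : ℝ} (hp : 1 ≤ p)
    (hE : HasPApproxProp p E) {f : F → E} (hf : ∀ x, AnalyticAt ℂ f x)
    (hfp : ∀ x, PCompactAt p f x) {K : Set F} (hK : IsCompact K) (hKb : Balanced ℂ K)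
    {a : ℕ → ℝ} (ha : Tendsto a atTop (nhds 0)) {ε : ℝ} (hε : 0 < ε) :
    ∃ (n : ℕ) (g : Fin n → F → ℂ) (v : Fin n → E),
      (∀ i, ∀ x, AnalyticAt ℂ (g i) x) ∧
      (Summable fun m => nachbinTerm K a (fun y => f y - ∑ i, g i y • v i) m) ∧
      (∑' m, nachbinTerm K a (fun y => f y - ∑ i, g i y • v i) m) ≤ ε := by
  obtain ⟨δ, hδ, hL⟩ := exists_cthickening_isRelPCompact hp hfp
    ((hK.image (continuous_const_smul (2 : ℂ))).union (isCompact_singleton (x := (0 : F))))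
  obtain ⟨m₀, hm₀⟩ := eventually_atTop.1 (ha.eventually_le_const (half_pos hδ))
  obtain ⟨R, hR⟩ : ∃ R, ∀ m, ∀ k ∈ K, ∀ u : F, ‖u‖ ≤ a m → ‖k + u‖ ≤ R := by
    obtain ⟨M, hM⟩ := hK.isBounded.exists_norm_le
    obtain ⟨A, hA⟩ := ha.bddAbove_range
    exact ⟨M + A, fun m k hk u hu =>
      norm_add_le_of_le (hM k hk) (hu.trans (hA ⟨m, rfl⟩))⟩
  set ρ : ℝ := max R δ / δ with hρ
  have hρ1 : 1 ≤ ρ := (one_le_div hδ).2 (le_max_right _ _)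
  have hρ0 : 0 < ρ := one_pos.trans_le hρ1
  set η : ℝ := ε / (m₀ * ρ ^ m₀ + 2) with hη
  have hη0 : 0 < η := by positivity
  obtain ⟨T, hT, hTη⟩ := hE _ hL η hη0
  let b := Module.finBasis ℂ (LinearMap.range (T : E →ₗ[ℂ] E))
  let T' : E →L[ℂ] LinearMap.range (T : E →ₗ[ℂ] E) := T.rangeRestrict
  let φ : Fin _ → E →L[ℂ] ℂ := fun i => (LinearMap.toContinuousLinearMap (b.coord i)) ∘L T'
  have hTφ : ∀ x, T x = ∑ i, φ i x • (b i : E) := fun x => by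
    have := congrArg Subtype.val (b.sum_repr (T' x))
    rw [Submodule.coe_sum] at this
    exact this.symm
  refine ⟨_, fun i x => φ i (f x), fun i => b i,
    fun i x => ((φ i).analyticAt _).comp (hf x), ?_⟩
  simp only [← hTφ]
  set H : F → E := fun y => f y - T (f y) with hH
  have hHa : ∀ x, AnalyticAt ℂ H x := fun x => (hf x).sub ((T.analyticAt _).comp (hf x))
  have hHη : ∀ z ∈ cthickening δ ((fun x => (2 : ℂ) • x) '' K ∪ {0}), ‖H z‖ ≤ η := fun z hz => by
    rw [hH, norm_sub_rev]
    exact hTη _ ⟨z, hz, rfl⟩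
  have hterm : ∀ m, nachbinTerm K a H m ≤ η * ((if m < m₀ then ρ ^ m₀ else 0) + (1 / 2) ^ m) := by
    intro m
    refine Real.sSup_le ?_ (by positivity)
    rintro _ ⟨x, hx, rfl⟩
    obtain ⟨k, hk, u, hu, rfl⟩ := hx
    rw [mem_closedBall_zero_iff] at hu
    split_ifs with hm
    · have hP : ‖taylorPoly H 0 m (((ρ⁻¹ : ℝ) : ℂ) • (k + u))‖ ≤ η := by
        refine norm_taylorPoly_le hHa m fun ζ hζ => hHη _ ?_
        refine mem_cthickening_of_dist_le _ 0 δ _ (Or.inr rfl) ?_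
        rw [dist_zero_right, norm_smul, norm_smul, hζ, one_mul, Complex.norm_real,
          Real.norm_of_nonneg (by positivity), hρ, inv_div, div_mul_eq_mul_div,
          div_le_iff₀ (lt_max_of_lt_right hδ)]
        gcongr
        exact (hR m k hk u hu).trans (le_max_left _ _)
      rw [taylorPoly_smul, norm_smul, norm_pow, Complex.norm_real,
        Real.norm_of_nonneg (by positivity), inv_pow, inv_mul_le_iff₀ (by positivity)] at hP
      calc _ ≤ ρ ^ m * η := hP
        _ ≤ ρ ^ m₀ * η := by gcongr
        _ ≤ η * (ρ ^ m₀ + (1 / 2) ^ m) := by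
          rw [mul_comm]
          gcongr
          exact le_add_of_nonneg_right (by positivity)
    · have hP : ‖taylorPoly H 0 m ((2 : ℂ) • (k + u))‖ ≤ η := by
        refine norm_taylorPoly_le hHa m fun ζ hζ => hHη _ ?_
        refine mem_cthickening_of_dist_le _ ((2 : ℂ) • ζ • k) δ _
          (Or.inl ⟨ζ • k, hKb.smul_mem hζ.le hk, rfl⟩) ?_
        rw [dist_eq_norm, smul_comm, ← smul_sub, ← smul_sub, add_sub_cancel_left, norm_smul,
          norm_smul, hζ, Complex.norm_ofNat]
        linarith [hm₀ m (not_lt.1 hm)]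
      rw [taylorPoly_smul, norm_smul, norm_pow, Complex.norm_ofNat] at hP
      rw [zero_add, one_div, inv_pow, ← div_eq_mul_inv, le_div_iff₀' (by positivity)]
      exact hP
  have hsum : HasSum (fun m : ℕ => η * ((if m < m₀ then ρ ^ m₀ else 0) + (1 / 2 : ℝ) ^ m)) ε := by
    have h1 : HasSum (fun m : ℕ => if m < m₀ then ρ ^ m₀ else 0) (m₀ * ρ ^ m₀) := by
      have : HasSum (fun m : ℕ => if m < m₀ then ρ ^ m₀ else 0)
          (∑ m ∈ Finset.range m₀, if m < m₀ then ρ ^ m₀ else 0) :=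
        hasSum_sum_of_ne_finset_zero fun m hm => if_neg (by simpa using hm)
      rwa [Finset.sum_congr rfl fun m hm => if_pos (Finset.mem_range.1 hm), Finset.sum_const,
        Finset.card_range, nsmul_eq_mul] at this
    convert! (h1.add hasSum_geometric_two).mul_left η using 1
    rw [hη]
    field_simp
  have hs := hsum.summable.of_nonneg_of_le (nachbinTerm_nonneg K a H) hterm
  exact ⟨hs, (hs.tsum_le_tsum hterm hsum.summable).trans hsum.tsum_eq.le⟩

/-- An operator that maps the images of balls of `ℓ_q` to `p`-convex hulls is `p`-compact. -/
lemma pCompactAt_of_lp {E Q : Type*} [NormedAddCommGroup E] [NormedSpace ℂ E]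
    [NormedAddCommGroup Q] [NormedSpace ℂ Q] {p : ℝ} {q : ℝ≥0∞} [Fact (1 ≤ q)]
    (hq : ∀ α : ℕ → ℂ, ConjUnitBall p α ↔
      ∃ a : lp (fun _ : ℕ => ℂ) q, ‖a‖ ≤ 1 ∧ ∀ n, a n = α n)
    {y : ℕ → E} (hy : Summable fun n => ‖y n‖ ^ p) {j : Q → E}
    (hj : ∀ z : Q, ∃ a : lp (fun _ : ℕ => ℂ) q, ‖a‖ ≤ ‖z‖ + 1 ∧
      HasSum (fun n => a n • y n) (j z)) (z₀ : Q) : PCompactAt p j z₀ := by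
  set r : ℝ := ‖z₀‖ + 2 with hr
  have hr0 : 0 < r := by positivity
  have hrc : (r : ℂ) ≠ 0 := by exact_mod_cast hr0.ne'
  refine ⟨ball z₀ 1, ball_mem_nhds _ one_pos, fun n => (r : ℂ) • y n, ?_, ?_⟩
  · simp_rw [norm_smul, Real.mul_rpow (norm_nonneg _) (norm_nonneg _)]
    exact hy.mul_left _
  · rintro _ ⟨z, hz, rfl⟩
    obtain ⟨a, ha, hs⟩ := hj z
    refine ⟨fun n => (r : ℂ)⁻¹ * a n, (hq _).2 ⟨(r : ℂ)⁻¹ • a, ?_, fun n => rfl⟩, ?_⟩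
    · rw [norm_smul, norm_inv, Complex.norm_real, Real.norm_of_nonneg hr0.le,
        inv_mul_le_iff₀ hr0, mul_one]
      have : ‖z‖ ≤ ‖z₀‖ + 1 := by
        have := norm_le_norm_add_norm_sub' z z₀
        rw [mem_ball, dist_eq_norm] at hz
        linarith
      linarith
    · have heq : (fun n => ((r : ℂ)⁻¹ * a n) • (r : ℂ) • y n) = fun n => a n • y n :=
        funext fun n => by rw [smul_smul, mul_right_comm, inv_mul_cancel₀ hrc, one_mul]
      change HasSum (fun n => ((r : ℂ)⁻¹ * a n) • (r : ℂ) • y n) (j z)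
      rw [heq]
      exact hs

/-- A space has the `p`-approximation property if the `p`-compact operators into it are norm limits
of finite rank operators. -/
lemma hasPApproxProp_of_operators {E : Type u} [NormedAddCommGroup E] [NormedSpace ℂ E]
    [CompleteSpace E] {p : ℝ} (hp : 1 ≤ p)
    (h : ∀ (F : Type u) (_ : NormedAddCommGroup F) (_ : NormedSpace ℂ F) (_ : CompleteSpace F)
      (j : F →L[ℂ] E), (∀ x, PCompactAt p j x) → ∀ ε : ℝ, 0 < ε →
      ∃ (N : ℕ) (e : Fin N → F →L[ℂ] ℂ) (v : Fin N → E), ‖j - ∑ i, (e i).smulRight (v i)‖ ≤ ε) :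
    HasPApproxProp p E := by
  rintro K ⟨x, hx, hK⟩ ε hε
  obtain ⟨c, y, hc0, hc, hy, hxy⟩ := exists_null_smul_summable hp hx
  obtain ⟨q, hq1, hpq, hq⟩ := exists_conjUnitBall_iff_lp hp
  have : Fact (1 ≤ q) := ⟨hq1⟩
  obtain ⟨S, hS⟩ := exists_lp_operator hp hpq hy
  obtain ⟨D, hD, hDapprox⟩ := exists_lp_diagonal (q := q) hc0 hc
  have : IsClosed (S.ker : Set (lp (fun _ : ℕ => ℂ) q)) := S.isClosed_ker
  let Q := lp (fun _ : ℕ => ℂ) q ⧸ S.ker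
  let π : lp (fun _ : ℕ => ℂ) q →L[ℂ] Q := S.ker.mkQL
  let j : Q →L[ℂ] E := S.ker.liftQL S le_rfl
  have hjπ : ∀ a, j (π a) = S a := fun a => rfl
  have hj : Function.Injective j := by
    refine (injective_iff_map_eq_zero j).2 fun z hz => ?_
    obtain ⟨a, rfl⟩ := Submodule.Quotient.mk_surjective _ z
    exact (Submodule.Quotient.mk_eq_zero _).2 hz
  let L : ULift.{u} Q ≃ₗᵢ[ℂ] Q := LinearIsometryEquiv.ulift ℂ Q
  let L' : ULift.{u} Q →L[ℂ] Q := L.toContinuousLinearEquiv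
  let L'' : Q →L[ℂ] ULift.{u} Q := L.symm.toContinuousLinearEquiv
  have hjL : ∀ z : ULift.{u} Q, ∃ a : lp (fun _ : ℕ => ℂ) q, ‖a‖ ≤ ‖z‖ + 1 ∧
      HasSum (fun n => a n • y n) ((j ∘L L') z) := by
    intro z
    obtain ⟨a, ha, hlt⟩ := Submodule.Quotient.norm_mk_lt (L z) one_pos
    refine ⟨a, by simpa using hlt.le, ?_⟩
    have hz : (j ∘L L') z = S a := by
      rw [← hjπ]
      exact congrArg j ha.symm
    rw [hz]
    exact hS a
  have hR : ∀ ε : ℝ, 0 < ε → ∃ (N : ℕ) (e : Fin N → Q →L[ℂ] ℂ) (v : Fin N → E),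
      ‖j - ∑ i, (e i).smulRight (v i)‖ ≤ ε := by
    intro ε hε
    obtain ⟨N, e, v, hN⟩ := h (ULift.{u} Q) inferInstance inferInstance inferInstance (j ∘L L')
      (pCompactAt_of_lp hq hy hjL) ε hε
    refine ⟨N, fun i => e i ∘L L'', v, ?_⟩
    refine ContinuousLinearMap.opNorm_le_bound _ hε.le fun z => ?_
    have := (j ∘L L' - ∑ i, (e i).smulRight (v i)).le_of_opNorm_le hN (L'' z)
    rw [← L.symm.norm_map z]
    simpa [L', L''] using this
  have hC : ∀ ε : ℝ, 0 < ε → ∃ (N : ℕ) (e : Fin N → lp (fun _ : ℕ => ℂ) q →L[ℂ] ℂ)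
      (v : Fin N → Q), ‖π ∘L D - ∑ i, (e i).smulRight (v i)‖ ≤ ε := by
    intro ε hε
    obtain ⟨N, e, v, hN⟩ := hDapprox (ε / (‖π‖ + 1)) (by positivity)
    refine ⟨N, e, fun i => π (v i), ?_⟩
    have heq : π ∘L D - ∑ i, (e i).smulRight (π (v i)) =
        π ∘L (D - ∑ i, (e i).smulRight (v i)) := by
      ext1 a
      simp
    rw [heq]
    refine (ContinuousLinearMap.opNorm_comp_le _ _).trans ?_
    calc ‖π‖ * ‖D - ∑ i, (e i).smulRight (v i)‖ ≤ (‖π‖ + 1) * (ε / (‖π‖ + 1)) := by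
          gcongr
          linarith
      _ = ε := mul_div_cancel₀ _ (by positivity)
  obtain ⟨T, hT, hTε⟩ := exists_finiteRank_approx hC hj hR hε
  refine ⟨T, hT, fun w hw => ?_⟩
  obtain ⟨α, hα, hs⟩ := hK hw
  obtain ⟨a, ha, haα⟩ := (hq α).1 hα
  have hw' : w = j ((π ∘L D) a) := by
    rw [ContinuousLinearMap.comp_apply, hjπ]
    refine hs.unique ?_
    convert! hS (D a) using 2 with n
    rw [hD, hxy, haα, mul_comm, mul_smul]
  rw [hw']
  exact hTε a ha

/-- **Proposition 4.9.** Let `E` be a Banach space and `1 ≤ p < ∞`.  Then `E` has the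
`p`-approximation property if and only if, for every Banach space `F`, the finite-rank
entire maps `H(F) ⊗ E` are dense, with respect to the Nachbin topology `τ_ω`, in the space
`H_{K_p}(F;E)` of `p`-compact entire functions from `F` to `E`. -/
theorem statement14 (E : Type u) [NormedAddCommGroup E] [NormedSpace ℂ E] [CompleteSpace E]
    (p : ℝ) (hp : 1 ≤ p) :
    HasPApproxProp p E ↔
      ∀ (F : Type u) (_ : NormedAddCommGroup F) (_ : NormedSpace ℂ F) (_ : CompleteSpace F)
        (f : F → E), (∀ x, AnalyticAt ℂ f x) → (∀ x : F, PCompactAt p f x) →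
        ∀ (K : Set F), IsCompact K → Convex ℝ K → Balanced ℂ K →
        ∀ (a : ℕ → ℝ), (∀ m, 0 < a m) → Filter.Tendsto a Filter.atTop (nhds 0) →
        ∀ ε : ℝ, 0 < ε →
          ∃ (n : ℕ) (g : Fin n → F → ℂ) (v : Fin n → E),
            (∀ i, ∀ x, AnalyticAt ℂ (g i) x) ∧
            (Summable fun m =>
              nachbinTerm K a (fun y => f y - ∑ i, g i y • v i) m) ∧
            (∑' m, nachbinTerm K a (fun y => f y - ∑ i, g i y • v i) m) ≤ ε := by
  refine ⟨fun hE F _ _ _ f hf hfp K hK _ hKb a _ ha ε hε =>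
    hE.exists_nachbin_approx hp hf hfp hK hKb ha hε, fun h => ?_⟩
  refine hasPApproxProp_of_operators hp fun F _ _ _ j hj ε hε => ?_
  exact exists_finiteRank_of_nachbin j
    (fun K hK hKc hKb a ha0 ha ε hε => h F _ _ inferInstance j (fun x => j.analyticAt x) hj K hK hKc
      hKb a ha0 ha ε hε) hε

end
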